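/- arXiv:2510.18088 — 2 statements merged into one kernel-verified Lean document; each statement's English description precedes it below -/
import Mathlib

section
/- Let H₁, H₂ : ℂ → ℂ be holomorphic on a punctured neighbourhood of 0 with at most simple poles at 0, and define G(z,w) := H₁(z+w)·H₂(z)·H₂(w). Let h₁, h₂, h₃, h₄ : ℂ × ℂ → ℂ be jointly holomorphic on a neighbourhood of (0,0) and satisfy, for all z, w in that neighbourhood: h₁(z,0) = h₃(z,0), h₂(z,0) = h₄(z,0), h₁(0,w) = h₂(0,w), h₃(0,w) = h₄(0,w), h₁(−z,z) = h₄(−z,z), and h₂(z,z) = h₃(z,z). Then the function (z,w) ↦ G(z,w)·h₁(z,w) + G(−z,w)·h₂(z,w) + G(z,−w)·h₃(z,w) + G(−z,−w)·h₄(z,w), defined for (z,w) in a punctured neighbourhood of (0,0) subject to z ≠ 0, w ≠ 0, z+w ≠ 0 and z−w ≠ 0, tends to a finite limit as (z,w) → (0,0) within this set. -/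
open Filter Topology

lemma triple_div {f : ℂ → ℂ} {R : ℝ} (hf : DifferentiableOn ℂ f (Metric.ball 0 R))
    {w : ℂ} (hw : w ≠ 0) (hwR : ‖w‖ < R) (h0 : f 0 = 0) (h1 : f w = 0) (h2 : f (-w) = 0) :
    ∃ q : ℂ → ℂ, DifferentiableOn ℂ q (Metric.ball 0 R) ∧
      ∀ z, f z = z * (z - w) * (z + w) * q z := by
  have hR : 0 < R := lt_of_le_of_lt (norm_nonneg _) hwR
  have m0 : Metric.ball (0:ℂ) R ∈ 𝓝 (0:ℂ) := Metric.ball_mem_nhds _ hR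
  have m1 : Metric.ball (0:ℂ) R ∈ 𝓝 w := Metric.isOpen_ball.mem_nhds (by simpa using hwR)
  have m2 : Metric.ball (0:ℂ) R ∈ 𝓝 (-w) := Metric.isOpen_ball.mem_nhds (by simpa using hwR)
  have e0 : ∀ z, f z = z * dslope f 0 z := fun z => by
    have := sub_smul_dslope f 0 z
    simp [h0] at this; exact this.symm
  have d1 := (Complex.differentiableOn_dslope m0).2 hf
  set f1 := dslope f 0
  have z1 : f1 w = 0 := by
    have := e0 w; rw [h1] at this; simpa [hw] using this.symm
  have z2 : f1 (-w) = 0 := by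
    have := e0 (-w); rw [h2] at this; simpa [hw] using this.symm
  have e1 : ∀ z, f1 z = (z - w) * dslope f1 w z := fun z => by
    have := sub_smul_dslope f1 w z
    simp [z1] at this; exact this.symm
  have d2 := (Complex.differentiableOn_dslope m1).2 d1
  set f2 := dslope f1 w
  have z3 : f2 (-w) = 0 := by
    have := e1 (-w); rw [z2] at this
    have hne : -w - w ≠ 0 := by
      intro h; apply hw; linear_combination (-1/2) * h
    simpa [hne] using this.symm
  have e2 : ∀ z, f2 z = (z + w) * dslope f2 (-w) z := fun z => by
    have := sub_smul_dslope f2 (-w) z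
    simp [z3] at this; exact this.symm
  have d3 := (Complex.differentiableOn_dslope m2).2 d2
  refine ⟨_, d3, fun z => ?_⟩
  rw [e0 z, e1 z, e2 z]; ring


lemma key {N : ℂ × ℂ → ℂ} (hN : AnalyticAt ℂ N (0, 0))
    (ha : ∀ᶠ t in 𝓝 (0:ℂ), N (t, 0) = 0) (hb : ∀ᶠ t in 𝓝 (0:ℂ), N (0, t) = 0)
    (hc : ∀ᶠ t in 𝓝 (0:ℂ), N (t, t) = 0) (hd : ∀ᶠ t in 𝓝 (0:ℂ), N (-t, t) = 0) :
    ∃ L : ℂ, Tendsto (fun p : ℂ × ℂ => N p / (p.1 * p.2 * (p.1 + p.2) * (p.1 - p.2)))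
      (𝓝[{p : ℂ × ℂ | p.1 ≠ 0 ∧ p.2 ≠ 0 ∧ p.1 + p.2 ≠ 0 ∧ p.1 - p.2 ≠ 0}] (0, 0)) (𝓝 L) := by
  obtain ⟨K, t, ht, hK⟩ := (hN.contDiffAt (n := 1)).exists_lipschitzOnWith
  obtain ⟨R1, hR1, hA⟩ := hN.exists_ball_analyticOnNhd
  obtain ⟨R2, hR2, hT⟩ := Metric.mem_nhds_iff.1 ht
  obtain ⟨R3, hR3, hZ⟩ := Metric.eventually_nhds_iff.1 ((ha.and hb).and (hc.and hd))
  obtain ⟨R, hR, h1, h2, h3⟩ : ∃ R, 0 < R ∧ R ≤ R1 ∧ R ≤ R2 ∧ R ≤ R3 :=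
    ⟨min R1 (min R2 R3), by positivity, by simp, by simp, by simp⟩
  obtain ⟨r, hr, hrR⟩ : ∃ r, 0 < r ∧ r < R := ⟨R / 2, by linarith, by linarith⟩
  have hmem : ∀ z w : ℂ, ‖z‖ < R → ‖w‖ < R → (z, w) ∈ Metric.ball ((0,0) : ℂ × ℂ) R := by
    intro z w hz hw
    simp [Prod.dist_eq, hz, hw]
  have hAn : ∀ z w : ℂ, ‖z‖ < R → ‖w‖ < R → AnalyticAt ℂ N (z, w) := fun z w hz hw =>
    hA _ (Metric.ball_subset_ball h1 (hmem z w hz hw))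
  have hz0 : ∀ t : ℂ, ‖t‖ < R → (N (t, 0) = 0 ∧ N (0, t) = 0) ∧ (N (t, t) = 0 ∧ N (-t, t) = 0) :=
    fun t ht => hZ (by simpa using ht.trans_le h3)
  have hbd : ∀ z w : ℂ, ‖z‖ < R → ‖w‖ < R → ‖N (z, w)‖ ≤ K * ‖w‖ := by
    intro z w hz hw
    have := hK.dist_le_mul (z, w) (hT (Metric.ball_subset_ball h2 (hmem z w hz hw))) (z, 0)
      (hT (Metric.ball_subset_ball h2 (hmem z 0 hz (by simpa using hR))))
    simpa [(hz0 z hz).1.1, Prod.dist_eq] using this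
  set S := {p : ℂ × ℂ | p.1 ≠ 0 ∧ p.2 ≠ 0 ∧ p.1 + p.2 ≠ 0 ∧ p.1 - p.2 ≠ 0} with hS
  have hev : ∀ᶠ p : ℂ × ℂ in 𝓝[S] (0,0), p ∈ S ∧ ‖p.1‖ < r / 2 ∧ ‖p.2‖ < r / 2 := by
    refine (eventually_mem_nhdsWithin).and (eventually_nhdsWithin_of_eventually_nhds ?_)
    have := Metric.ball_mem_nhds ((0,0) : ℂ × ℂ) (half_pos hr)
    filter_upwards [this] with p hp
    simpa [Prod.dist_eq] using hp
  have hcirc : ∀ θ, ‖circleMap 0 r θ‖ = r := fun θ => by simp [abs_of_pos hr]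
  have hlow : ∀ z w : ℂ, ‖z‖ = r → ‖w‖ < r / 2 → r / 2 ≤ ‖z - w‖ := by
    intro z w hz hw
    have := norm_sub_norm_le z w
    linarith
  let F : ℂ × ℂ → ℂ → ℂ := fun p ζ =>
    (ζ - p.1)⁻¹ • (N (ζ, p.2) / p.2 / (ζ * (ζ - p.2) * (ζ + p.2)))
  let F0 : ℂ → ℂ := fun ζ => (ζ - 0)⁻¹ • (deriv (fun w => N (ζ, w)) 0 / (ζ * (ζ - 0) * (ζ + 0)))
  have hlim : Tendsto (fun p => ∮ ζ in C(0, r), F p ζ) (𝓝[S] (0,0)) (𝓝 (∮ ζ in C(0, r), F0 ζ)) := by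
    refine intervalIntegral.tendsto_integral_filter_of_dominated_convergence
      (fun _ => r * ((r/2)⁻¹ * (K / (r/2 * (r/2) * (r/2))))) ?_ ?_ (by simp) ?_
    · filter_upwards [hev] with p hp
      obtain ⟨⟨hp1, hp2, hp3, hp4⟩, hp5, hp6⟩ := hp
      refine Continuous.aestronglyMeasurable ?_
      have hne : ∀ θ, ∀ w : ℂ, ‖w‖ < r / 2 → circleMap 0 r θ - w ≠ 0 := by
        intro θ w hw h0
        have := hlow _ w (hcirc θ) hw
        rw [h0, norm_zero] at this; linarith
      have c1 : Continuous (fun θ => N (circleMap 0 r θ, p.2)) := by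
        rw [continuous_iff_continuousAt]
        intro θ
        have h := (hAn (circleMap 0 r θ) p.2 (by rw [hcirc]; exact hrR) (by linarith)).continuousAt
        exact ContinuousAt.comp (f := fun θ => (circleMap 0 r θ, p.2)) h
          (by have := continuous_circleMap 0 r; fun_prop)
      have c2 := continuous_circleMap 0 r
      simp only [deriv_circleMap, F]
      refine Continuous.fun_smul (c2.mul continuous_const) (Continuous.fun_smul ?_ ?_)
      · exact (c2.sub continuous_const).inv₀ (fun θ => hne θ _ hp5)
      · refine (c1.div_const _).div (by fun_prop) fun θ => ?_
        refine mul_ne_zero (mul_ne_zero ?_ (hne θ _ hp6)) ?_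
        · simpa using hne θ 0 (by simpa using hr)
        · simpa using hne θ (-p.2) (by simpa using hp6)
    · filter_upwards [hev] with p hp
      obtain ⟨⟨hp1, hp2, hp3, hp4⟩, hp5, hp6⟩ := hp
      refine Eventually.of_forall fun θ _ => ?_
      have hζ := hcirc θ
      have hd : ‖deriv (circleMap 0 r) θ‖ = r := by simp [abs_of_pos hr]
      rw [norm_smul, hd]
      generalize circleMap 0 r θ = ζ at hζ
      have b1 := hlow ζ p.1 hζ hp5
      have b2 := hlow ζ p.2 hζ hp6
      have b3 := hlow ζ (-p.2) hζ (by simpa using hp6)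
      rw [sub_neg_eq_add] at b3
      have b4 : r / 2 ≤ ‖ζ‖ := by rw [hζ]; linarith
      have b5 : ‖N (ζ, p.2)‖ / ‖p.2‖ ≤ K := by
        rw [div_le_iff₀ (norm_pos_iff.2 hp2)]
        exact hbd _ _ (by linarith) (by linarith)
      have hr2 : 0 < r / 2 := by linarith
      simp only [F, norm_smul, norm_inv, norm_div, norm_mul]
      gcongr
    · refine Eventually.of_forall fun θ _ => ?_
      have hζ := hcirc θ
      refine Tendsto.const_smul ?_ _
      generalize circleMap 0 r θ = ζ at hζ
      have hζ0 : ζ ≠ 0 := by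
        rintro rfl; simp at hζ; linarith
      have hid : Tendsto (fun p : ℂ × ℂ => p) (𝓝[S] (0,0)) (𝓝 (0,0)) := tendsto_id.mono_left nhdsWithin_le_nhds
      have t1 : Tendsto (fun p : ℂ × ℂ => p.1) (𝓝[S] (0,0)) (𝓝 0) :=
        (continuous_fst.tendsto ((0,0) : ℂ × ℂ)).comp hid
      have t2 : Tendsto (fun p : ℂ × ℂ => p.2) (𝓝[S] (0,0)) (𝓝 0) :=
        (continuous_snd.tendsto ((0,0) : ℂ × ℂ)).comp hid
      have t3 : Tendsto (fun p : ℂ × ℂ => p.2) (𝓝[S] (0,0)) (𝓝[≠] 0) := by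
        refine tendsto_nhdsWithin_iff.2 ⟨t2, ?_⟩
        filter_upwards [hev] with p hp using hp.1.2.1
      have hdiff : DifferentiableAt ℂ (fun w => N (ζ, w)) 0 := by
        have h := (hAn ζ 0 (by linarith) (by simpa using hR)).differentiableAt
        exact DifferentiableAt.comp (f := fun w : ℂ => (ζ, w)) 0 h (by fun_prop)
      have t4 := hdiff.hasDerivAt.tendsto_slope.comp t3
      have t5 : Tendsto (fun p : ℂ × ℂ => N (ζ, p.2) / p.2) (𝓝[S] (0,0))
          (𝓝 (deriv (fun w => N (ζ, w)) 0)) := by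
        refine t4.congr fun p => ?_
        simp [slope_def_field, (hz0 ζ (by linarith)).1.1]
      simp only [F, F0]
      refine Tendsto.smul ((tendsto_const_nhds.sub t1).inv₀ (by simpa using hζ0)) ?_
      refine t5.div ((tendsto_const_nhds.mul (tendsto_const_nhds.sub t2)).mul
        (tendsto_const_nhds.add t2)) (by simpa using hζ0)
  refine ⟨_, (hlim.const_smul ((2 * Real.pi * Complex.I : ℂ)⁻¹)).congr' ?_⟩
  filter_upwards [hev] with p hp
  obtain ⟨⟨hp1, hp2, hp3, hp4⟩, hp5, hp6⟩ := hp
  have hwR : ‖p.2‖ < R := by linarith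
  have hdf : DifferentiableOn ℂ (fun z => N (z, p.2)) (Metric.ball 0 R) := by
    intro z hz
    have h := (hAn z p.2 (by simpa using hz) hwR).differentiableAt
    exact (DifferentiableAt.comp (f := fun z : ℂ => (z, p.2)) z h (by fun_prop)).differentiableWithinAt
  obtain ⟨q, hq, hqe⟩ := triple_div hdf hp2 hwR (hz0 _ hwR).1.2 (hz0 _ hwR).2.1 (hz0 _ hwR).2.2
  have hcau := DifferentiableOn.circleIntegral_sub_inv_smul (c := 0) (R := r) (w := p.1)
    (f := fun ζ => q ζ / p.2)
    ((hq.mono (Metric.closedBall_subset_ball hrR)).div_const _) (by simp; linarith)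
  have hEq : (∮ ζ in C(0, r), F p ζ) = ∮ ζ in C(0, r), (ζ - p.1)⁻¹ • (q ζ / p.2) := by
    refine circleIntegral.integral_congr hr.le fun ζ hζ => ?_
    have hζ' : ‖ζ‖ = r := by simpa using hζ
    have b2 := hlow ζ p.2 hζ' hp6
    have b3 := hlow ζ (-p.2) hζ' (by simpa using hp6)
    rw [sub_neg_eq_add] at b3
    have n1 : ζ ≠ 0 := norm_pos_iff.1 (by linarith)
    have n2 : ζ - p.2 ≠ 0 := norm_pos_iff.1 (by linarith)
    have n3 : ζ + p.2 ≠ 0 := norm_pos_iff.1 (by linarith)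
    simp only [F]
    congr 1
    have := hqe ζ
    rw [this]
    field_simp
  rw [hEq, hcau, smul_smul, inv_mul_cancel₀ Complex.two_pi_I_ne_zero, one_smul]
  have := hqe p.1
  simp only [Prod.mk.eta] at this
  rw [this]
  field_simp



/-- Let `H₁, H₂ : ℂ → ℂ` be holomorphic on a punctured neighbourhood of `0`
with at most simple poles at `0` (i.e. `u ↦ u * Hᵢ u` extends holomorphically across `0`),
and define `G z w := H₁ (z+w) * H₂ z * H₂ w`. Let `h₁, h₂, h₃, h₄` be jointly holomorphic on
a neighbourhood of `(0,0)` satisfying the stated symmetry relations. Then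
`G z w * h₁ (z,w) + G (-z) w * h₂ (z,w) + G z (-w) * h₃ (z,w) + G (-z) (-w) * h₄ (z,w)`
tends to a finite limit as `(z,w) → (0,0)` within the set where `z, w, z+w, z-w ≠ 0`. -/
theorem stmt0
    (H₁ H₂ : ℂ → ℂ) (h₁ h₂ h₃ h₄ : ℂ × ℂ → ℂ)
    (U : Set ℂ) (hU : U ∈ 𝓝 (0 : ℂ))
    (hH₁ : AnalyticOnNhd ℂ H₁ (U \ {0}))
    (hH₂ : AnalyticOnNhd ℂ H₂ (U \ {0}))
    (g₁ g₂ : ℂ → ℂ)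
    (hg₁ : AnalyticOnNhd ℂ g₁ U) (hg₂ : AnalyticOnNhd ℂ g₂ U)
    (hg₁eq : ∀ u ∈ U \ {0}, g₁ u = u * H₁ u)
    (hg₂eq : ∀ u ∈ U \ {0}, g₂ u = u * H₂ u)
    (V : Set (ℂ × ℂ)) (hV : V ∈ 𝓝 ((0, 0) : ℂ × ℂ))
    (hh₁ : AnalyticOnNhd ℂ h₁ V) (hh₂ : AnalyticOnNhd ℂ h₂ V)
    (hh₃ : AnalyticOnNhd ℂ h₃ V) (hh₄ : AnalyticOnNhd ℂ h₄ V)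
    (hr₁ : ∀ z : ℂ, (z, (0 : ℂ)) ∈ V → h₁ (z, 0) = h₃ (z, 0))
    (hr₂ : ∀ z : ℂ, (z, (0 : ℂ)) ∈ V → h₂ (z, 0) = h₄ (z, 0))
    (hr₃ : ∀ w : ℂ, ((0 : ℂ), w) ∈ V → h₁ (0, w) = h₂ (0, w))
    (hr₄ : ∀ w : ℂ, ((0 : ℂ), w) ∈ V → h₃ (0, w) = h₄ (0, w))
    (hr₅ : ∀ z : ℂ, (-z, z) ∈ V → h₁ (-z, z) = h₄ (-z, z))
    (hr₆ : ∀ z : ℂ, (z, z) ∈ V → h₂ (z, z) = h₃ (z, z)) :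
    ∃ L : ℂ,
      Tendsto
        (fun p : ℂ × ℂ =>
          H₁ (p.1 + p.2) * H₂ p.1 * H₂ p.2 * h₁ p
            + H₁ (-p.1 + p.2) * H₂ (-p.1) * H₂ p.2 * h₂ p
            + H₁ (p.1 - p.2) * H₂ p.1 * H₂ (-p.2) * h₃ p
            + H₁ (-p.1 - p.2) * H₂ (-p.1) * H₂ (-p.2) * h₄ p)
        (𝓝[{p : ℂ × ℂ | p.1 ≠ 0 ∧ p.2 ≠ 0 ∧ p.1 + p.2 ≠ 0 ∧ p.1 - p.2 ≠ 0}] (0, 0))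
        (𝓝 L) := by

  let N : ℂ × ℂ → ℂ := fun p =>
    (p.1 - p.2) * (g₁ (p.1 + p.2) * g₂ p.1 * g₂ p.2 * h₁ p
        - g₁ (-p.1 - p.2) * g₂ (-p.1) * g₂ (-p.2) * h₄ p)
      + (p.1 + p.2) * (g₁ (-p.1 + p.2) * g₂ (-p.1) * g₂ p.2 * h₂ p
        - g₁ (p.1 - p.2) * g₂ p.1 * g₂ (-p.2) * h₃ p)
  have G1 : AnalyticAt ℂ g₁ 0 := hg₁ 0 (mem_of_mem_nhds hU)
  have G2 : AnalyticAt ℂ g₂ 0 := hg₂ 0 (mem_of_mem_nhds hU)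
  have A1 := hh₁ _ (mem_of_mem_nhds hV)
  have A2 := hh₂ _ (mem_of_mem_nhds hV)
  have A3 := hh₃ _ (mem_of_mem_nhds hV)
  have A4 := hh₄ _ (mem_of_mem_nhds hV)
  have cg : ∀ {g : ℂ → ℂ} (l : ℂ × ℂ → ℂ), AnalyticAt ℂ g 0 → AnalyticAt ℂ l (0,0) →
      l (0,0) = 0 → AnalyticAt ℂ (fun p => g (l p)) (0,0) := by
    intro g l hg hl h0
    exact AnalyticAt.comp (by rw [h0]; exact hg) hl
  have f1 : AnalyticAt ℂ (fun p : ℂ × ℂ => p.1) (0,0) := analyticAt_fst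
  have f2 : AnalyticAt ℂ (fun p : ℂ × ℂ => p.2) (0,0) := analyticAt_snd
  have hN : AnalyticAt ℂ N (0,0) := by
    have a1 := cg _ G1 (f1.fun_add f2) (by simp)
    have a2 := cg _ G1 (f1.fun_neg.fun_sub f2) (by simp)
    have a3 := cg _ G1 (f1.fun_neg.fun_add f2) (by simp)
    have a4 := cg _ G1 (f1.fun_sub f2) (by simp)
    have b1 := cg _ G2 f1 (by simp)
    have b2 := cg _ G2 f2 (by simp)
    have b3 := cg _ G2 f1.fun_neg (by simp)
    have b4 := cg _ G2 f2.fun_neg (by simp)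
    exact ((f1.fun_sub f2).fun_mul ((((a1.fun_mul b1).fun_mul b2).fun_mul A1).fun_sub
      (((a2.fun_mul b3).fun_mul b4).fun_mul A4))).fun_add
      ((f1.fun_add f2).fun_mul ((((a3.fun_mul b3).fun_mul b2).fun_mul A2).fun_sub
      (((a4.fun_mul b1).fun_mul b4).fun_mul A3)))
  have ev : ∀ l : ℂ → ℂ × ℂ, Continuous l → l 0 = (0,0) → ∀ᶠ t in 𝓝 (0:ℂ), l t ∈ V := by
    intro l hl h0
    exact hl.continuousAt.eventually_mem (by rw [h0]; exact hV)
  obtain ⟨L, hL⟩ := key hN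
    (by
      filter_upwards [ev (fun t => (t, 0)) (by fun_prop) rfl] with t ht
      simp only [N, hr₁ t ht, hr₂ t ht, add_zero, sub_zero, neg_zero]; ring)
    (by
      filter_upwards [ev (fun t => (0, t)) (by fun_prop) rfl] with t ht
      simp only [N, hr₃ t ht, hr₄ t ht, zero_add, zero_sub, neg_zero]; ring)
    (by
      filter_upwards [ev (fun t => (t, t)) (by fun_prop) rfl] with t ht
      simp only [N, hr₆ t ht, sub_self, neg_add_cancel]; ring)
    (by
      filter_upwards [ev (fun t => (-t, t)) (by fun_prop) (by simp)] with t ht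
      simp only [N, hr₅ t ht, neg_neg, sub_self, neg_add_cancel]; ring)
  refine ⟨L, hL.congr' ?_⟩
  have evU : ∀ l : ℂ × ℂ → ℂ, Continuous l → l (0,0) = 0 → ∀ᶠ p in 𝓝 ((0,0) : ℂ × ℂ), l p ∈ U := by
    intro l hl h0
    exact hl.continuousAt.eventually_mem (by rw [h0]; exact hU)
  filter_upwards [eventually_mem_nhdsWithin,
    nhdsWithin_le_nhds (evU (fun p => p.1 + p.2) (by fun_prop) (by simp)),
    nhdsWithin_le_nhds (evU (fun p => -p.1 + p.2) (by fun_prop) (by simp)),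
    nhdsWithin_le_nhds (evU (fun p => p.1 - p.2) (by fun_prop) (by simp)),
    nhdsWithin_le_nhds (evU (fun p => -p.1 - p.2) (by fun_prop) (by simp)),
    nhdsWithin_le_nhds (evU (fun p => p.1) (by fun_prop) (by simp)),
    nhdsWithin_le_nhds (evU (fun p => p.2) (by fun_prop) (by simp)),
    nhdsWithin_le_nhds (evU (fun p => -p.1) (by fun_prop) (by simp)),
    nhdsWithin_le_nhds (evU (fun p => -p.2) (by fun_prop) (by simp))] with p hp u1 u2 u3 u4 u5 u6 u7 u8
  obtain ⟨n1, n2, n3, n4⟩ := hp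
  have n5 : -p.1 + p.2 ≠ 0 := fun h => n4 (by linear_combination -h)
  have n6 : -p.1 - p.2 ≠ 0 := fun h => n3 (by linear_combination -h)
  simp only [N]
  rw [hg₁eq _ ⟨u1, n3⟩, hg₁eq _ ⟨u2, n5⟩, hg₁eq _ ⟨u3, n4⟩, hg₁eq _ ⟨u4, n6⟩,
    hg₂eq _ ⟨u5, n1⟩, hg₂eq _ ⟨u6, n2⟩, hg₂eq _ ⟨u7, neg_ne_zero.2 n1⟩,
    hg₂eq _ ⟨u8, neg_ne_zero.2 n2⟩]
  rw [div_eq_iff (mul_ne_zero (mul_ne_zero (mul_ne_zero n1 n2) n3) n4)]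
  ring
end

section
/- Let H₁, H₂ : ℂ → ℂ be holomorphic on a punctured neighbourhood of 0 with at most simple poles at 0, and set a := lim_{u→0} u·H₁(u) and b := lim_{u→0} u·H₂(u). Let h₁, h₂, h₃, h₄ : ℂ × ℂ → ℂ be jointly holomorphic on a neighbourhood of (0,0) satisfying h₁(z,0) = h₃(z,0), h₂(z,0) = h₄(z,0), h₁(0,w) = h₂(0,w), h₃(0,w) = h₄(0,w), h₁(−z,z) = h₄(−z,z), and h₂(z,z) = h₃(z,z) for all z, w near 0. For a real number N > 1 define G_N(z,w) := N^{z+w}·H₁(z+w)·H₂(z)·H₂(w). Then there exist constants c₀, c₁, c₂ ∈ ℂ, independent of N, such that for every real N > 1 the limit as (z,w) → (0,0) (within the set where z, w, z+w, z−w are all nonzero) of G_N(z,w)·h₁(z,w) + G_N(−z,w)·h₂(z,w) + G_N(z,−w)·h₃(z,w) + G_N(−z,−w)·h₄(z,w) exists and equals (4/3)·a·b²·h₁(0,0)·(log N)³ + c₂·(log N)² + c₁·log N + c₀. -/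
open Filter Topology


lemma aux_div (f : ℂ → ℂ) (R : ℝ) (c : ℂ) (hc : c ∈ Metric.ball (0:ℂ) R)
    (hf : DifferentiableOn ℂ f (Metric.ball 0 R)) (h0 : f c = 0) :
    ∃ q : ℂ → ℂ, DifferentiableOn ℂ q (Metric.ball 0 R) ∧ ∀ x, x ≠ c → q x = f x / (x - c) := by
  refine ⟨dslope f c, (Complex.differentiableOn_dslope (Metric.isOpen_ball.mem_nhds hc)).2 hf, ?_⟩
  intro x hx
  rw [dslope_of_ne _ hx, slope_def_field, h0, sub_zero]

lemma aux_cauchy (f : ℂ → ℂ) (R r : ℝ) (hr : r < R) (z : ℂ) (hz : z ∈ Metric.ball (0:ℂ) r)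
    (hf : DifferentiableOn ℂ f (Metric.ball 0 R)) :
    f z = (2 * Real.pi * Complex.I : ℂ)⁻¹ * ∮ x in C(0, r), f x / (x - z) := by
  have h1 : DiffContOnCl ℂ f (Metric.ball 0 r) := by
    apply DifferentiableOn.diffContOnCl
    exact hf.mono (Metric.closure_ball_subset_closedBall.trans (Metric.closedBall_subset_ball hr))
  have := h1.two_pi_i_inv_smul_circleIntegral_sub_inv_smul hz
  rw [← this, smul_eq_mul]
  congr 2
  ext x
  simp [div_eq_inv_mul]

lemma aux_cont {X : Type*} [TopologicalSpace X] (f : X → ℂ → ℂ) (r : ℝ)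
    (hf : Continuous fun p : X × ℝ => f p.1 (circleMap 0 r p.2)) :
    Continuous fun x => ∮ y in C(0, r), f x y := by
  unfold circleIntegral
  apply intervalIntegral.continuous_parametric_intervalIntegral_of_continuous'
  simp only [deriv_circleMap, smul_eq_mul]
  have : Continuous fun p : X × ℝ => circleMap 0 r p.2 * Complex.I := by fun_prop
  exact this.mul hf

lemma aux_one (f : ℂ → ℂ) (R r : ℝ) (hr : r < R) (hf : DifferentiableOn ℂ f (Metric.ball 0 R))
    (h0 : f 0 = 0) (z : ℂ) (hz : z ∈ Metric.ball (0:ℂ) r) (hz0 : z ≠ 0) :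
    f z / z = (2 * Real.pi * Complex.I : ℂ)⁻¹ * ∮ x in C(0, r), f x / (x * (x - z)) := by
  have hz' := Metric.mem_ball.1 hz
  have hr0 : 0 < r := lt_of_le_of_lt dist_nonneg hz'
  obtain ⟨q, hq, hqe⟩ := aux_div f R 0 (Metric.mem_ball_self (hr0.trans hr)) hf h0
  have := aux_cauchy q R r hr z hz hq
  rw [hqe z hz0, sub_zero] at this
  rw [this]
  congr 1
  apply circleIntegral.integral_congr hr0.le
  intro x hx
  have : x ≠ 0 := ne_zero_of_mem_sphere hr0.ne' ⟨x, hx⟩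
  simp only
  rw [hqe x this, sub_zero, div_div]

lemma aux_three (f : ℂ → ℂ) (R r : ℝ) (hr : r < R) (hf : DifferentiableOn ℂ f (Metric.ball 0 R))
    (w : ℂ) (hw : w ∈ Metric.ball (0:ℂ) r) (hw0 : w ≠ 0)
    (h0 : f 0 = 0) (h1 : f w = 0) (h2 : f (-w) = 0)
    (z : ℂ) (hz : z ∈ Metric.ball (0:ℂ) r) (hz0 : z ≠ 0) (hz1 : z ≠ w) (hz2 : z ≠ -w) :
    f z / (z * (z - w) * (z + w)) = (2 * Real.pi * Complex.I : ℂ)⁻¹ *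
      ∮ x in C(0, r), f x / (x * (x - w) * (x + w) * (x - z)) := by
  have hz' := Metric.mem_ball.1 hz
  have hr0 : 0 < r := lt_of_le_of_lt dist_nonneg hz'
  have hwr : ‖w‖ < r := by simpa using hw
  have hww : -w ≠ w := by
    intro h; apply hw0; linear_combination (-1/2:ℂ) * h
  obtain ⟨q, hq, hqe⟩ := aux_div f R 0 (Metric.mem_ball_self (hr0.trans hr)) hf h0
  obtain ⟨q1, hq1, hqe1⟩ := aux_div q R w (Metric.ball_subset_ball hr.le hw) hq
    (by rw [hqe w hw0, h1, zero_div])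
  obtain ⟨q2, hq2, hqe2⟩ := aux_div q1 R (-w) (by simpa using hwr.trans hr) hq1
    (by rw [hqe1 _ hww, hqe _ (neg_ne_zero.2 hw0), h2, zero_div, zero_div])
  have key : ∀ x, x ≠ 0 → x ≠ w → x ≠ -w → q2 x = f x / (x * (x - w) * (x + w)) := by
    intro x a b c
    rw [hqe2 x c, hqe1 x b, hqe x a, sub_zero, div_div, div_div, sub_neg_eq_add, mul_assoc]
  have := aux_cauchy q2 R r hr z hz hq2
  rw [key z hz0 hz1 hz2] at this
  rw [this]
  congr 1
  apply circleIntegral.integral_congr hr0.le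
  intro x hx
  have hxr : ‖x‖ = r := by simpa using hx
  simp only
  rw [key x, div_div]
  · rintro rfl; simp at hxr; linarith
  · rintro rfl; linarith
  · rintro rfl; rw [norm_neg] at hxr; linarith

/-- Existence of limit. -/
lemma aux_lim (Φ : ℂ × ℂ → ℂ) (hΦ : AnalyticAt ℂ Φ (0, 0))
    (e1 : ∀ᶠ z : ℂ in 𝓝 0, Φ (z, 0) = 0) (e2 : ∀ᶠ z : ℂ in 𝓝 0, Φ (0, z) = 0)
    (e3 : ∀ᶠ z : ℂ in 𝓝 0, Φ (z, z) = 0) (e4 : ∀ᶠ z : ℂ in 𝓝 0, Φ (-z, z) = 0) :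
    ∃ c : ℂ, Tendsto (fun p : ℂ × ℂ => Φ p / (p.1 * p.2 * (p.1 + p.2) * (p.1 - p.2)))
      (𝓝[{p : ℂ × ℂ | p.1 ≠ 0 ∧ p.2 ≠ 0 ∧ p.1 + p.2 ≠ 0 ∧ p.1 - p.2 ≠ 0}] (0, 0)) (𝓝 c) := by
  obtain ⟨R1, hR1, han⟩ := hΦ.exists_ball_analyticOnNhd
  obtain ⟨R2, hR2, hv⟩ := Metric.eventually_nhds_iff_ball.1 (e1.and (e2.and (e3.and e4)))
  set R := min R1 R2 with hR
  have hRpos : 0 < R := lt_min hR1 hR2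
  have hd : ∀ z w : ℂ, ‖z‖ < R → ‖w‖ < R → DifferentiableAt ℂ Φ (z, w) := by
    intro z w hz hw
    apply (han (z, w) _).differentiableAt
    rw [Metric.mem_ball, Prod.dist_eq]
    simp only [dist_zero_right]
    exact max_lt (hz.trans_le (min_le_left _ _)) (hw.trans_le (min_le_left _ _))
  have hv' : ∀ z : ℂ, ‖z‖ < R → Φ (z, 0) = 0 ∧ Φ (0, z) = 0 ∧ Φ (z, z) = 0 ∧ Φ (-z, z) = 0 :=
    fun z hz => hv z (by simpa using hz.trans_le (min_le_right _ _))
  have hv'' : ∀ z : ℂ, ‖z‖ < R → Φ (z, -z) = 0 := by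
    intro z hz
    have := (hv' (-z) (by simpa using hz)).2.2.2
    simpa using this
  set r := R / 2 with hr
  have hr0 : 0 < r := by positivity
  have hrR : r < R := by rw [hr]; linarith
  let K : ℂ × ℂ → ℂ → ℂ := fun p x => ∮ y in C(0, r), Φ (x, y) / (y * (y - p.2))
  let Q : ℂ × ℂ → ℂ := fun p => (2 * Real.pi * Complex.I : ℂ)⁻¹ *
      ∮ x in C(0, r), ((2 * Real.pi * Complex.I : ℂ)⁻¹ * K p x) /
        (x * (x - p.2) * (x + p.2) * (x - p.1))
  have hform : ∀ z w : ℂ, ‖z‖ < r → ‖w‖ < r → z ≠ 0 → w ≠ 0 → z + w ≠ 0 → z - w ≠ 0 →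
      Φ (z, w) / (z * w * (z + w) * (z - w)) = Q (z, w) := by
    intro z w hz hw hz0 hw0 h1 h2
    have hwR := hw.trans hrR
    have A := aux_three (fun x => Φ (x, w) / w) R r hrR
      (by
        intro x hx
        have hx : ‖x‖ < R := by simpa using hx
        have : DifferentiableAt ℂ (fun x => Φ (x, w)) x :=
          DifferentiableAt.comp x (f := fun x => (x, w)) (hd x w hx hwR) (by fun_prop)
        exact (this.div_const w).differentiableWithinAt)
      w (by simpa using hw) hw0 (by simp [(hv' w hwR).2.1]) (by simp [(hv' w hwR).2.2.1])
      (by simp [(hv' w hwR).2.2.2]) z (by simpa using hz) hz0 (sub_ne_zero.1 h2)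
      (by intro h; apply h1; rw [h]; ring)
    have : Φ (z, w) / (z * w * (z + w) * (z - w)) = Φ (z, w) / w / (z * (z - w) * (z + w)) := by
      rw [div_div]; congr 1; ring
    rw [this, A]
    simp only [Q, K]
    congr 1
    apply circleIntegral.integral_congr hr0.le
    intro x hx
    have hxr : ‖x‖ = r := by simpa using hx
    have hxR : ‖x‖ < R := hxr ▸ hrR
    simp only
    congr 1
    apply aux_one (fun y => Φ (x, y)) R r hrR _ (hv' x hxR).1 w (by simpa using hw) hw0
    intro y hy
    have hy : ‖y‖ < R := by simpa using hy
    exact (DifferentiableAt.comp y (f := fun y => (x, y)) (hd x y hxR hy) (by fun_prop)).differentiableWithinAt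
  -- continuity
  let B := Metric.ball ((0, 0) : ℂ × ℂ) r
  have hB : ∀ p : B, ‖p.1.1‖ < r ∧ ‖p.1.2‖ < r := by
    intro p
    have := p.2
    simp only [B, Metric.mem_ball, Prod.dist_eq, dist_zero_right, max_lt_iff] at this
    exact this
  have hcm : ∀ θ, ‖circleMap 0 r θ‖ = r := by intro θ; simp [abs_of_pos hr0]
  have hcne : ∀ θ (w : ℂ), ‖w‖ < r → circleMap 0 r θ - w ≠ 0 := by
    intro θ w hw h
    have := hcm θ
    rw [sub_eq_zero.1 h] at this
    linarith
  have hc0 : ∀ θ, circleMap 0 r θ ≠ 0 := by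
    intro θ; simpa using hcne θ 0 (by simpa using hr0)
  have hKc : Continuous fun q : B × ℝ => K q.1.1 (circleMap 0 r q.2) := by
    apply aux_cont (fun (q : B × ℝ) y => Φ (circleMap 0 r q.2, y) / (y * (y - q.1.1.2)))
    apply Continuous.div
    · rw [continuous_iff_continuousAt]
      intro q
      have h1 := (hd (circleMap 0 r q.1.2) (circleMap 0 r q.2) ((hcm _).trans_lt hrR)
        ((hcm _).trans_lt hrR)).continuousAt
      exact ContinuousAt.comp (f := fun q : (B × ℝ) × ℝ => (circleMap 0 r q.1.2, circleMap 0 r q.2))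
        h1 (by fun_prop)
    · fun_prop
    · intro q
      exact mul_ne_zero (hc0 _) (hcne _ _ (hB _).2)
  have hQc : Continuous fun p : B => Q p.1 := by
    apply Continuous.mul continuous_const
    apply aux_cont (fun (p : B) x => ((2 * Real.pi * Complex.I : ℂ)⁻¹ * K p.1 x) /
        (x * (x - p.1.2) * (x + p.1.2) * (x - p.1.1)))
    apply Continuous.div
    · exact continuous_const.mul hKc
    · fun_prop
    · intro q
      refine mul_ne_zero (mul_ne_zero (mul_ne_zero (hc0 _) (hcne _ _ (hB _).2)) ?_) 
        (hcne _ _ (hB _).1)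
      have := hcne q.2 (-q.1.1.2) (by simpa using (hB q.1).2)
      simpa using this
  have hBn : B ∈ 𝓝 ((0, 0) : ℂ × ℂ) := Metric.ball_mem_nhds _ hr0
  have hQ0 : ContinuousAt Q (0, 0) :=
    (continuousOn_iff_continuous_domRestrict.2 hQc).continuousAt hBn
  refine ⟨Q (0, 0), ?_⟩
  refine (hQ0.tendsto.mono_left nhdsWithin_le_nhds).congr' ?_
  filter_upwards [self_mem_nhdsWithin, mem_nhdsWithin_of_mem_nhds hBn] with p hp hpB
  exact (hform p.1 p.2 (hB ⟨p, hpB⟩).1 (hB ⟨p, hpB⟩).2 hp.1 hp.2.1 hp.2.2.1 hp.2.2.2).symm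

/-- The four-fold combination, with `H₁ u = G u / u` and `H₂ u = g u / u`. -/
noncomputable def auxT (g : ℂ → ℂ) (h₁ h₂ h₃ h₄ : ℂ × ℂ → ℂ) (G : ℂ → ℂ) (p : ℂ × ℂ) : ℂ :=
  G (p.1 + p.2) * g p.1 * g p.2 * h₁ p / ((p.1 + p.2) * p.1 * p.2)
    + G (-p.1 + p.2) * g (-p.1) * g p.2 * h₂ p / ((-p.1 + p.2) * (-p.1) * p.2)
    + G (p.1 - p.2) * g p.1 * g (-p.2) * h₃ p / ((p.1 - p.2) * p.1 * (-p.2))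
    + G (-p.1 - p.2) * g (-p.1) * g (-p.2) * h₄ p / ((-p.1 - p.2) * (-p.1) * (-p.2))

lemma auxT_lim (g : ℂ → ℂ) (h₁ h₂ h₃ h₄ : ℂ × ℂ → ℂ) (G : ℂ → ℂ)
    (hG : AnalyticAt ℂ G 0) (hg : AnalyticAt ℂ g 0)
    (hh₁ : AnalyticAt ℂ h₁ (0, 0)) (hh₂ : AnalyticAt ℂ h₂ (0, 0))
    (hh₃ : AnalyticAt ℂ h₃ (0, 0)) (hh₄ : AnalyticAt ℂ h₄ (0, 0))
    (hr₁ : ∀ᶠ z : ℂ in 𝓝 0, h₁ (z, 0) = h₃ (z, 0))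
    (hr₂ : ∀ᶠ z : ℂ in 𝓝 0, h₂ (z, 0) = h₄ (z, 0))
    (hr₃ : ∀ᶠ w : ℂ in 𝓝 0, h₁ (0, w) = h₂ (0, w))
    (hr₄ : ∀ᶠ w : ℂ in 𝓝 0, h₃ (0, w) = h₄ (0, w))
    (hr₅ : ∀ᶠ z : ℂ in 𝓝 0, h₁ (-z, z) = h₄ (-z, z))
    (hr₆ : ∀ᶠ z : ℂ in 𝓝 0, h₂ (z, z) = h₃ (z, z)) :
    ∃ c : ℂ, Tendsto (auxT g h₁ h₂ h₃ h₄ G)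
      (𝓝[{p : ℂ × ℂ | p.1 ≠ 0 ∧ p.2 ≠ 0 ∧ p.1 + p.2 ≠ 0 ∧ p.1 - p.2 ≠ 0}] (0, 0)) (𝓝 c) := by
  have comp : ∀ (f : ℂ → ℂ) (l : ℂ × ℂ → ℂ), AnalyticAt ℂ f 0 → AnalyticAt ℂ l (0, 0) →
      l (0, 0) = 0 → AnalyticAt ℂ (fun p => f (l p)) (0, 0) := by
    intro f l hf hl h0
    exact AnalyticAt.fun_comp (f := l) (by rw [h0]; exact hf) hl
  have f1 : AnalyticAt ℂ (fun p : ℂ × ℂ => p.1) (0, 0) := analyticAt_fst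
  have f2 : AnalyticAt ℂ (fun p : ℂ × ℂ => p.2) (0, 0) := analyticAt_snd
  have g1 := comp g _ hg f1 rfl
  have g2 := comp g _ hg f2 rfl
  have g1n := comp g _ hg f1.fun_neg (by simp)
  have g2n := comp g _ hg f2.fun_neg (by simp)
  have G1 := comp G _ hG (f1.fun_add f2) (by simp)
  have G2 := comp G _ hG (f1.fun_neg.fun_add f2) (by simp)
  have G3 := comp G _ hG (f1.fun_sub f2) (by simp)
  have G4 := comp G _ hG (f1.fun_neg.fun_sub f2) (by simp)
  obtain ⟨c, hc⟩ := aux_lim (fun p : ℂ × ℂ =>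
      G (p.1 + p.2) * g p.1 * g p.2 * h₁ p * (p.1 - p.2)
      + G (-p.1 + p.2) * g (-p.1) * g p.2 * h₂ p * (p.1 + p.2)
      - G (p.1 - p.2) * g p.1 * g (-p.2) * h₃ p * (p.1 + p.2)
      - G (-p.1 - p.2) * g (-p.1) * g (-p.2) * h₄ p * (p.1 - p.2))
    (by
      exact ((((((G1.fun_mul g1).fun_mul g2).fun_mul hh₁).fun_mul (f1.fun_sub f2)).fun_add
        ((((G2.fun_mul g1n).fun_mul g2).fun_mul hh₂).fun_mul (f1.fun_add f2))).fun_sub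
        ((((G3.fun_mul g1).fun_mul g2n).fun_mul hh₃).fun_mul (f1.fun_add f2))).fun_sub
        ((((G4.fun_mul g1n).fun_mul g2n).fun_mul hh₄).fun_mul (f1.fun_sub f2)))
    (by
      filter_upwards [hr₁, hr₂] with z e1 e2
      simp only [e1, e2, add_zero, sub_zero, neg_zero]; ring)
    (by
      filter_upwards [hr₃, hr₄] with z e1 e2
      simp only [e1, e2, zero_add, zero_sub, neg_zero]; ring)
    (by
      filter_upwards [hr₆] with z e1
      simp only [e1, sub_self, neg_add_cancel]; ring)
    (by
      filter_upwards [hr₅] with z e1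
      simp only [e1, sub_self, neg_add_cancel, neg_neg]; ring)
  refine ⟨c, hc.congr' ?_⟩
  filter_upwards [self_mem_nhdsWithin] with p hp
  obtain ⟨a1, a2, a3, a4⟩ := hp
  have a5 : -p.1 + p.2 ≠ 0 := by
    intro h; apply a4; linear_combination -h
  have a6 : -p.1 - p.2 ≠ 0 := by
    intro h; apply a3; linear_combination -h
  simp only [auxT]
  have b5 : (-p.1 + p.2) * (-p.1) * p.2 = (p.1 - p.2) * p.1 * p.2 := by ring
  have b6 : (p.1 - p.2) * p.1 * (-p.2) = -((p.1 - p.2) * p.1 * p.2) := by ring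
  have b7 : (-p.1 - p.2) * (-p.1) * (-p.2) = -((p.1 + p.2) * p.1 * p.2) := by ring
  rw [b5, b6, b7]
  generalize G (p.1 + p.2) * g p.1 * g p.2 * h₁ p = A
  generalize G (-p.1 + p.2) * g (-p.1) * g p.2 * h₂ p = B
  generalize G (p.1 - p.2) * g p.1 * g (-p.2) * h₃ p = C
  generalize G (-p.1 - p.2) * g (-p.1) * g (-p.2) * h₄ p = D
  field_simp
  ring

lemma aux_exp (L : ℂ) : Tendsto (fun u : ℂ =>
    (Complex.exp (u * L) - 1 - L * u - L ^ 2 / 2 * u ^ 2) / u ^ 3) (𝓝[≠] 0) (𝓝 (L ^ 3 / 6)) := by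
  have h := Complex.exp_sub_sum_range_isBigO_pow 4
  have hl : Tendsto (fun u : ℂ => u * L) (𝓝[≠] 0) (𝓝 0) := by
    have : Tendsto (fun u : ℂ => u * L) (𝓝 0) (𝓝 (0 * L)) :=
      (continuous_id.mul continuous_const).tendsto 0
    rw [zero_mul] at this
    exact this.mono_left nhdsWithin_le_nhds
  have h2 := h.comp_tendsto hl
  have h3 : (fun u : ℂ => (u * L) ^ 4) =O[𝓝[≠] 0] (fun u : ℂ => u ^ 4) := by
    simp only [mul_pow]
    simpa [mul_comm] using Asymptotics.isBigO_const_mul_self (L ^ 4) (fun u : ℂ => u ^ 4) (𝓝[≠] 0)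
  have h4 := h2.trans h3
  have h5 : (fun u : ℂ => u ^ 4) =o[𝓝[≠] 0] (fun u : ℂ => u ^ 3) :=
    (Asymptotics.isLittleO_pow_pow (by norm_num : 3 < 4)).mono nhdsWithin_le_nhds
  have h6 := (h4.trans_isLittleO h5).tendsto_div_nhds_zero
  have h7 := h6.add_const (L ^ 3 / 6)
  rw [zero_add] at h7
  refine h7.congr' ?_
  filter_upwards [self_mem_nhdsWithin] with u hu
  have hu : u ≠ 0 := hu
  simp [Finset.sum_range_succ, Nat.factorial]
  field_simp
  ring

lemma auxT_val (g : ℂ → ℂ) (h₁ h₂ h₃ h₄ : ℂ × ℂ → ℂ) (G : ℂ → ℂ) (c κ : ℂ)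
    (hg : ContinuousAt g 0)
    (hh₁ : ContinuousAt h₁ (0, 0)) (hh₂ : ContinuousAt h₂ (0, 0))
    (hh₃ : ContinuousAt h₃ (0, 0)) (hh₄ : ContinuousAt h₄ (0, 0))
    (e2 : h₂ (0, 0) = h₁ (0, 0)) (e3 : h₃ (0, 0) = h₁ (0, 0)) (e4 : h₄ (0, 0) = h₁ (0, 0))
    (hG : Tendsto (fun u => G u / u ^ 3) (𝓝[≠] 0) (𝓝 κ))
    (hc : Tendsto (auxT g h₁ h₂ h₃ h₄ G)
      (𝓝[{p : ℂ × ℂ | p.1 ≠ 0 ∧ p.2 ≠ 0 ∧ p.1 + p.2 ≠ 0 ∧ p.1 - p.2 ≠ 0}] (0, 0)) (𝓝 c)) :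
    c = 8 * κ * g 0 ^ 2 * h₁ (0, 0) := by
  have hpath0 : Tendsto (fun z : ℂ => (z, 2 * z)) (𝓝[≠] 0) (𝓝 (0, 0)) := by
    have : Continuous (fun z : ℂ => (z, 2 * z)) := by fun_prop
    have h := this.tendsto 0
    simp only [mul_zero] at h
    exact h.mono_left nhdsWithin_le_nhds
  have hpath : Tendsto (fun z : ℂ => (z, 2 * z)) (𝓝[≠] 0)
      (𝓝[{p : ℂ × ℂ | p.1 ≠ 0 ∧ p.2 ≠ 0 ∧ p.1 + p.2 ≠ 0 ∧ p.1 - p.2 ≠ 0}] (0, 0)) := by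
    refine tendsto_nhdsWithin_iff.2 ⟨hpath0, ?_⟩
    filter_upwards [self_mem_nhdsWithin] with z hz
    have hz : z ≠ 0 := hz
    refine ⟨hz, by simpa using hz, ?_, ?_⟩
    · intro h; apply hz; linear_combination h / 3
    · intro h; apply hz; linear_combination -h
  have hlin : ∀ m : ℂ, Tendsto (fun z : ℂ => m * z) (𝓝[≠] 0) (𝓝 0) := by
    intro m
    have : Continuous (fun z : ℂ => m * z) := by fun_prop
    have h := this.tendsto 0
    rw [mul_zero] at h
    exact h.mono_left nhdsWithin_le_nhds
  have hgm : ∀ m : ℂ, Tendsto (fun z : ℂ => g (m * z)) (𝓝[≠] 0) (𝓝 (g 0)) :=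
    fun m => hg.tendsto.comp (hlin m)
  have hGm : ∀ m : ℂ, m ≠ 0 → Tendsto (fun z : ℂ => G (m * z) / (m * z) ^ 3) (𝓝[≠] 0) (𝓝 κ) := by
    intro m hm
    refine hG.comp (tendsto_nhdsWithin_iff.2 ⟨hlin m, ?_⟩)
    filter_upwards [self_mem_nhdsWithin] with z hz
    exact mul_ne_zero hm hz
  have t1 := ((((hGm 3 (by norm_num)).mul (hgm 1)).mul (hgm 2)).mul
    (hh₁.tendsto.comp hpath0)).const_mul (9 / 2)
  have t2 := ((((hGm 1 (by norm_num)).mul (hgm (-1))).mul (hgm 2)).mul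
    (hh₂.tendsto.comp hpath0)).const_mul (-1 / 2)
  have t3 := ((((hGm (-1) (by norm_num)).mul (hgm 1)).mul (hgm (-2))).mul
    (hh₃.tendsto.comp hpath0)).const_mul (-1 / 2)
  have t4 := ((((hGm (-3) (by norm_num)).mul (hgm (-1))).mul (hgm (-2))).mul
    (hh₄.tendsto.comp hpath0)).const_mul (9 / 2)
  have t := ((t1.add t2).add t3).add t4
  have hu := hc.comp hpath
  have := tendsto_nhds_unique_of_eventuallyEq hu t ?_
  · rw [this, e2, e3, e4]; ring
  · filter_upwards [self_mem_nhdsWithin] with z hz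
    have hz : z ≠ 0 := hz
    simp only [auxT, Function.comp]
    rw [show z + 2 * z = 3 * z by ring, show -z + 2 * z = 1 * z by ring,
      show z - 2 * z = -1 * z by ring, show -z - 2 * z = -3 * z by ring,
      show -(2 * z) = -2 * z by ring, show -z = -1 * z by ring,
      show g z = g (1 * z) by rw [one_mul]]
    field_simp
    ring



/-- With `H₁, H₂` holomorphic on a punctured neighbourhood of `0` with at most
simple poles at `0`, residues `a = lim u·H₁(u)`, `b = lim u·H₂(u)`, and `h₁,…,h₄` jointly
holomorphic near `(0,0)` satisfying the symmetry relations, for `N > 1` and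
`G_N z w := N^(z+w) · H₁(z+w) · H₂ z · H₂ w` (with `N^u = exp (u · log N)`), the limit of the
four-fold combination as `(z,w) → (0,0)` (with `z, w, z+w, z-w ≠ 0`) exists and equals
`(4/3)·a·b²·h₁(0,0)·(log N)³ + c₂·(log N)² + c₁·log N + c₀` for constants `c₀, c₁, c₂`
independent of `N`. -/
theorem stmt1
    (H₁ H₂ : ℂ → ℂ) (h₁ h₂ h₃ h₄ : ℂ × ℂ → ℂ)
    (U : Set ℂ) (hU : U ∈ 𝓝 (0 : ℂ))
    (hH₁ : AnalyticOnNhd ℂ H₁ (U \ {0}))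
    (hH₂ : AnalyticOnNhd ℂ H₂ (U \ {0}))
    (g₁ g₂ : ℂ → ℂ)
    (hg₁ : AnalyticOnNhd ℂ g₁ U) (hg₂ : AnalyticOnNhd ℂ g₂ U)
    (hg₁eq : ∀ u ∈ U \ {0}, g₁ u = u * H₁ u)
    (hg₂eq : ∀ u ∈ U \ {0}, g₂ u = u * H₂ u)
    (a b : ℂ)
    (ha : Tendsto (fun u : ℂ => u * H₁ u) (𝓝[≠] (0 : ℂ)) (𝓝 a))
    (hb : Tendsto (fun u : ℂ => u * H₂ u) (𝓝[≠] (0 : ℂ)) (𝓝 b))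
    (V : Set (ℂ × ℂ)) (hV : V ∈ 𝓝 ((0, 0) : ℂ × ℂ))
    (hh₁ : AnalyticOnNhd ℂ h₁ V) (hh₂ : AnalyticOnNhd ℂ h₂ V)
    (hh₃ : AnalyticOnNhd ℂ h₃ V) (hh₄ : AnalyticOnNhd ℂ h₄ V)
    (hr₁ : ∀ z : ℂ, (z, (0 : ℂ)) ∈ V → h₁ (z, 0) = h₃ (z, 0))
    (hr₂ : ∀ z : ℂ, (z, (0 : ℂ)) ∈ V → h₂ (z, 0) = h₄ (z, 0))
    (hr₃ : ∀ w : ℂ, ((0 : ℂ), w) ∈ V → h₁ (0, w) = h₂ (0, w))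
    (hr₄ : ∀ w : ℂ, ((0 : ℂ), w) ∈ V → h₃ (0, w) = h₄ (0, w))
    (hr₅ : ∀ z : ℂ, (-z, z) ∈ V → h₁ (-z, z) = h₄ (-z, z))
    (hr₆ : ∀ z : ℂ, (z, z) ∈ V → h₂ (z, z) = h₃ (z, z)) :
    ∃ c₀ c₁ c₂ : ℂ, ∀ N : ℝ, 1 < N →
      Tendsto
        (fun p : ℂ × ℂ =>
          Complex.exp ((p.1 + p.2) * (Real.log N : ℂ))
              * H₁ (p.1 + p.2) * H₂ p.1 * H₂ p.2 * h₁ p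
            + Complex.exp ((-p.1 + p.2) * (Real.log N : ℂ))
              * H₁ (-p.1 + p.2) * H₂ (-p.1) * H₂ p.2 * h₂ p
            + Complex.exp ((p.1 - p.2) * (Real.log N : ℂ))
              * H₁ (p.1 - p.2) * H₂ p.1 * H₂ (-p.2) * h₃ p
            + Complex.exp ((-p.1 - p.2) * (Real.log N : ℂ))
              * H₁ (-p.1 - p.2) * H₂ (-p.1) * H₂ (-p.2) * h₄ p)
        (𝓝[{p : ℂ × ℂ | p.1 ≠ 0 ∧ p.2 ≠ 0 ∧ p.1 + p.2 ≠ 0 ∧ p.1 - p.2 ≠ 0}] (0, 0))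
        (𝓝 ((4 / 3 : ℂ) * a * b ^ 2 * h₁ (0, 0) * (Real.log N : ℂ) ^ 3
              + c₂ * (Real.log N : ℂ) ^ 2 + c₁ * (Real.log N : ℂ) + c₀)) := by
  have hU0 : (0:ℂ) ∈ U := mem_of_mem_nhds hU
  have hV0 : ((0, 0) : ℂ × ℂ) ∈ V := mem_of_mem_nhds hV
  have A1 := hg₁ 0 hU0
  have A2 := hg₂ 0 hU0
  have hpun : ∀ᶠ u : ℂ in 𝓝[≠] 0, u ∈ U \ {0} := by
    filter_upwards [self_mem_nhdsWithin, mem_nhdsWithin_of_mem_nhds hU] with u h1 h2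
    exact ⟨h2, h1⟩
  have ea : g₁ 0 = a := by
    refine tendsto_nhds_unique_of_eventuallyEq
      (A1.continuousAt.tendsto.mono_left nhdsWithin_le_nhds) ha ?_
    filter_upwards [hpun] with u hu using hg₁eq u hu
  have eb : g₂ 0 = b := by
    refine tendsto_nhds_unique_of_eventuallyEq
      (A2.continuousAt.tendsto.mono_left nhdsWithin_le_nhds) hb ?_
    filter_upwards [hpun] with u hu using hg₂eq u hu
  have hev : ∀ l : ℂ → ℂ × ℂ, Continuous l → l 0 = (0, 0) → ∀ᶠ z in 𝓝 0, l z ∈ V := by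
    intro l hl h0
    have := hl.tendsto 0
    rw [h0] at this
    exact this hV
  have k₁ := (hev (fun z => (z, 0)) (by fun_prop) rfl).mono hr₁
  have k₂ := (hev (fun z => (z, 0)) (by fun_prop) rfl).mono hr₂
  have k₃ := (hev (fun z => (0, z)) (by fun_prop) rfl).mono hr₃
  have k₄ := (hev (fun z => (0, z)) (by fun_prop) rfl).mono hr₄
  have k₅ := (hev (fun z => (-z, z)) (by fun_prop) (by simp)).mono hr₅
  have k₆ := (hev (fun z => (z, z)) (by fun_prop) rfl).mono hr₆
  have B1 := hh₁ _ hV0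
  have B2 := hh₂ _ hV0
  have B3 := hh₃ _ hV0
  have B4 := hh₄ _ hV0
  have lim : ∀ G : ℂ → ℂ, AnalyticAt ℂ G 0 → ∃ c : ℂ, Tendsto (auxT g₂ h₁ h₂ h₃ h₄ G)
      (𝓝[{p : ℂ × ℂ | p.1 ≠ 0 ∧ p.2 ≠ 0 ∧ p.1 + p.2 ≠ 0 ∧ p.1 - p.2 ≠ 0}] (0, 0)) (𝓝 c) :=
    fun G hG => auxT_lim g₂ h₁ h₂ h₃ h₄ G hG A2 B1 B2 B3 B4 k₁ k₂ k₃ k₄ k₅ k₆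
  obtain ⟨c₀, hc₀⟩ := lim g₁ A1
  obtain ⟨c₁, hc₁⟩ := lim (fun u => u * g₁ u) (analyticAt_id.fun_mul A1)
  obtain ⟨c₂, hc₂⟩ := lim (fun u => u ^ 2 * g₁ u) ((analyticAt_id.fun_pow 2).fun_mul A1)
  refine ⟨c₀, c₁, c₂ / 2, ?_⟩
  intro N _
  generalize (Real.log N : ℂ) = L
  have hG3 : AnalyticAt ℂ
      (fun u => (Complex.exp (u * L) - 1 - L * u - L ^ 2 / 2 * u ^ 2) * g₁ u) 0 := by
    refine AnalyticAt.fun_mul ?_ A1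
    have : Differentiable ℂ (fun u : ℂ => Complex.exp (u * L) - 1 - L * u - L ^ 2 / 2 * u ^ 2) := by
      fun_prop
    exact this.analyticAt 0
  obtain ⟨c₃, hc₃⟩ := lim _ hG3
  have v := auxT_val g₂ h₁ h₂ h₃ h₄ _ c₃ (L ^ 3 / 6 * g₁ 0) A2.continuousAt B1.continuousAt
    B2.continuousAt B3.continuousAt B4.continuousAt (hr₃ 0 hV0).symm (hr₁ 0 hV0).symm
    ((hr₂ 0 hV0).symm.trans (hr₃ 0 hV0).symm)
    (((aux_exp L).mul (A1.continuousAt.tendsto.mono_left nhdsWithin_le_nhds)).congr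
      (fun u => by ring)) hc₃
  have t := ((hc₃.add (hc₂.const_mul (L ^ 2 / 2))).add (hc₁.const_mul L)).add hc₀
  have ev : c₃ + L ^ 2 / 2 * c₂ + L * c₁ + c₀ = (4 / 3 : ℂ) * a * b ^ 2 * h₁ (0, 0) * L ^ 3
      + c₂ / 2 * L ^ 2 + c₁ * L + c₀ := by
    rw [v, ea, eb]; ring
  rw [ev] at t
  refine t.congr' ?_
  have hevU : ∀ l : ℂ × ℂ → ℂ, Continuous l → l (0, 0) = 0 → ∀ᶠ p in
      𝓝[{p : ℂ × ℂ | p.1 ≠ 0 ∧ p.2 ≠ 0 ∧ p.1 + p.2 ≠ 0 ∧ p.1 - p.2 ≠ 0}] (0, 0), l p ∈ U := by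
    intro l hl h0
    have := hl.tendsto (0, 0)
    rw [h0] at this
    exact (this.mono_left nhdsWithin_le_nhds) hU
  filter_upwards [self_mem_nhdsWithin, hevU (fun p => p.1) (by fun_prop) rfl,
    hevU (fun p => p.2) (by fun_prop) rfl, hevU (fun p => -p.1) (by fun_prop) (by simp),
    hevU (fun p => -p.2) (by fun_prop) (by simp), hevU (fun p => p.1 + p.2) (by fun_prop) (by simp),
    hevU (fun p => -p.1 + p.2) (by fun_prop) (by simp),
    hevU (fun p => p.1 - p.2) (by fun_prop) (by simp),
    hevU (fun p => -p.1 - p.2) (by fun_prop) (by simp)] with p hp u1 u2 u3 u4 u5 u6 u7 u8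
  obtain ⟨a1, a2, a3, a4⟩ := hp
  have a5 : -p.1 + p.2 ≠ 0 := by
    intro h; apply a4; linear_combination -h
  have a6 : -p.1 - p.2 ≠ 0 := by
    intro h; apply a3; linear_combination -h
  have q₁ : ∀ u, u ∈ U → u ≠ 0 → H₁ u = g₁ u / u := by
    intro u hu h0
    rw [hg₁eq u ⟨hu, h0⟩]; field_simp
  have q₂ : ∀ u, u ∈ U → u ≠ 0 → H₂ u = g₂ u / u := by
    intro u hu h0
    rw [hg₂eq u ⟨hu, h0⟩]; field_simp
  rw [q₁ _ u5 a3, q₁ _ u6 a5, q₁ _ u7 a4, q₁ _ u8 a6, q₂ _ u1 a1, q₂ _ u2 a2,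
    q₂ _ u3 (neg_ne_zero.2 a1), q₂ _ u4 (neg_ne_zero.2 a2)]
  simp only [auxT, div_eq_mul_inv, mul_inv]
  ring
end
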